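/- arXiv:math/0410454 — 2 statements merged into one kernel-verified Lean document; each statement's English description precedes it below -/
import Mathlib

section
/- Every element b of B⁺ admits a unique maximal left divisor lying in 𝐖: there exists a unique α(b) ∈ 𝐖 such that α(b) ≼ b and every c ∈ 𝐖 with c ≼ b satisfies c ≼ α(b). -/
/-!
Artin–Tits braid monoid of a finite Coxeter system `(W,S)`, presented with one
generator `𝐰` for each `w ∈ W` and relations `𝐰₁𝐰₂ = 𝐰` when `w = w₁w₂` with
`l(w₁) + l(w₂) = l(w)`.
-/

variable {B : Type*} {W : Type*} [Group W] {M : CoxeterMatrix B}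

/-- The defining relations of the braid monoid. -/
def braidRel (cs : CoxeterSystem M W) : FreeMonoid W → FreeMonoid W → Prop := fun a b =>
  ∃ w₁ w₂ : W, cs.length (w₁ * w₂) = cs.length w₁ + cs.length w₂ ∧
    a = FreeMonoid.of w₁ * FreeMonoid.of w₂ ∧ b = FreeMonoid.of (w₁ * w₂)

/-- The braid monoid `B⁺` of the Coxeter system `cs`. -/
abbrev BraidMonoid (cs : CoxeterSystem M W) := PresentedMonoid (braidRel cs)

/-- The canonical element `𝐰 ∈ B⁺` attached to `w ∈ W`. -/
def bOf (cs : CoxeterSystem M W) (w : W) : BraidMonoid cs := PresentedMonoid.of (braidRel cs) w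

/-- The canonical morphism `β : B⁺ → W`, `𝐰 ↦ w`. -/
noncomputable def bPi (cs : CoxeterSystem M W) : BraidMonoid cs →* W :=
  PresentedMonoid.lift (fun w : W => w) (by
    rintro a b ⟨w₁, w₂, -, rfl, rfl⟩
    simp)

/-- The additive length morphism `l : B⁺ → ℕ` with `l(𝐬) = 1`; recorded as a morphism
to `Multiplicative ℕ`. It sends `𝐰` to `l(w)`. -/
noncomputable def bLen (cs : CoxeterSystem M W) : BraidMonoid cs →* Multiplicative ℕ :=
  PresentedMonoid.lift (fun w : W => Multiplicative.ofAdd (cs.length w)) (by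
    rintro a b ⟨w₁, w₂, h, rfl, rfl⟩
    simp [← ofAdd_add, h])

/-- The set `𝐖 = {b ∈ B⁺ : l(b) = l(β(b))}`, a copy of `W` inside `B⁺`. -/
def bW (cs : CoxeterSystem M W) : Set (BraidMonoid cs) :=
  {b | bLen cs b = Multiplicative.ofAdd (cs.length (bPi cs b))}

namespace CoxeterSystem

variable (cs : CoxeterSystem M W)

/-! ### Parity of left inversions -/

open Classical in
/-- A simple reflection `s` acting on `W × ZMod 2` by conjugation on the first coordinate, the
second coordinate being shifted exactly at `s`. -/
noncomputable def parityStep (i : B) : Function.End (W × ZMod 2) := fun p =>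
  (cs.simple i * p.1 * cs.simple i, p.2 + if p.1 = cs.simple i then 1 else 0)

open Classical in
theorem parityStep_mul_pow (i j : B) (k : ℕ) (g : W) (e : ZMod 2) :
    ((cs.parityStep i * cs.parityStep j) ^ k) (g, e) =
      ((cs.simple i * cs.simple j) ^ k * g * ((cs.simple i * cs.simple j) ^ k)⁻¹,
        e + ∑ n ∈ Finset.range (2 * k),
          if g = ((cs.simple i * cs.simple j) ^ n)⁻¹ * cs.simple j then 1 else 0) := by
  set h := cs.simple i * cs.simple j with hh
  have hs : ∀ k : ℕ, cs.simple j * h ^ k = (h ^ k)⁻¹ * cs.simple j := by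
    intro k
    have : SemiconjBy (cs.simple j) h h⁻¹ := by
      simp [SemiconjBy, hh, mul_assoc]
    simpa [SemiconjBy, inv_pow] using this.pow_right k
  induction k with
  | zero => simp; rfl
  | succ k ih =>
    rw [pow_succ', show ((cs.parityStep i * cs.parityStep j) *
      (cs.parityStep i * cs.parityStep j) ^ k) (g, e) = cs.parityStep i (cs.parityStep j
        (((cs.parityStep i * cs.parityStep j) ^ k) (g, e))) from rfl, ih,
      show 2 * (k + 1) = 2 * k + 1 + 1 by ring, Finset.sum_range_succ, Finset.sum_range_succ]
    have h1 : h ^ k * g * (h ^ k)⁻¹ = cs.simple j ↔ g = (h ^ (2 * k))⁻¹ * cs.simple j := by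
      rw [two_mul, pow_add, mul_inv_rev, mul_assoc _ _ (cs.simple j), ← hs, ← mul_assoc,
        mul_inv_eq_iff_eq_mul, mul_assoc, eq_inv_mul_iff_mul_eq]
    have h2 : cs.simple j * (h ^ k * g * (h ^ k)⁻¹) * cs.simple j = cs.simple i ↔
        g = (h ^ (2 * k + 1))⁻¹ * cs.simple j := by
      have : (h ^ (2 * k + 1))⁻¹ * cs.simple j
          = (h ^ k)⁻¹ * (cs.simple j * cs.simple i * cs.simple j) * h ^ k := by
        rw [show 2 * k + 1 = k + 1 + k by ring, pow_add, pow_succ, mul_inv_rev, mul_inv_rev,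
          mul_assoc, mul_assoc, mul_assoc, mul_assoc, ← hs, hh]
        simp [mul_assoc]
      rw [this]
      constructor
      · intro H
        rw [← H]
        simp [mul_assoc]
      · rintro rfl
        simp [mul_assoc]
    refine Prod.ext ?_ ?_
    · simp [parityStep, pow_succ', hh, mul_assoc]
    · simp only [parityStep, h1, h2, add_assoc]

theorem isLiftable_parityStep : M.IsLiftable cs.parityStep := by
  classical
  intro i j
  funext ⟨g, e⟩
  rw [parityStep_mul_pow, two_mul, Finset.sum_range_add]
  simp [pow_add, CharTwo.add_self_eq_zero]
  rfl

/-- The action of `W` on `W × ZMod 2` extending `parityStep`. -/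
noncomputable def parityAction : W →* Function.End (W × ZMod 2) :=
  cs.lift ⟨cs.parityStep, cs.isLiftable_parityStep⟩

theorem parityAction_simple (i : B) : cs.parityAction (cs.simple i) = cs.parityStep i :=
  cs.lift_apply_simple cs.isLiftable_parityStep i

/-- The parity of the number of occurrences of `g` in the left inversion sequence of any word
for `w`. -/
noncomputable def leftParity (w g : W) : ZMod 2 := (cs.parityAction w⁻¹ (g, 0)).2

theorem parityAction_apply (w g : W) (e : ZMod 2) :
    cs.parityAction w (g, e) = (w * g * w⁻¹, e + cs.leftParity w⁻¹ g) := by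
  unfold leftParity
  rw [inv_inv]
  induction w using cs.simple_induction_left generalizing g e with
  | one =>
    rw [map_one]
    change (g, e) = (1 * g * 1⁻¹, e + 0)
    simp
  | mul_simple_left w i ih =>
    rw [map_mul, show ∀ e : ZMod 2, (cs.parityAction (cs.simple i) * cs.parityAction w) (g, e) =
      cs.parityAction (cs.simple i) (cs.parityAction w (g, e)) from fun _ => rfl, ih,
      show ∀ e : ZMod 2, (cs.parityAction (cs.simple i) * cs.parityAction w) (g, e) =
      cs.parityAction (cs.simple i) (cs.parityAction w (g, e)) from fun _ => rfl, ih g 0,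
      parityAction_simple]
    simp [parityStep, mul_assoc, add_assoc]

theorem leftParity_mul (a b g : W) :
    cs.leftParity (a * b) g = cs.leftParity a g + cs.leftParity b (a⁻¹ * g * a) := by
  conv_lhs => rw [leftParity, mul_inv_rev, map_mul]
  change (cs.parityAction b⁻¹ (cs.parityAction a⁻¹ (g, 0))).2 = _
  simp [parityAction_apply]

theorem leftParity_one (g : W) : cs.leftParity 1 g = 0 := by
  rw [leftParity, inv_one, map_one]
  rfl

open Classical in
theorem leftParity_simple (i : B) (g : W) :
    cs.leftParity (cs.simple i) g = if g = cs.simple i then 1 else 0 := by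
  simp [leftParity, parityAction_simple, parityStep]

theorem mem_leftInvSeq_of_leftParity_ne_zero (ω : List B) (g : W)
    (h : cs.leftParity (cs.wordProd ω) g ≠ 0) : g ∈ cs.leftInvSeq ω := by
  classical
  induction ω generalizing g with
  | nil => simp [leftParity_one] at h
  | cons i ω ih =>
    rw [wordProd_cons, leftParity_mul, leftParity_simple] at h
    rw [leftInvSeq, List.mem_cons, List.mem_map]
    by_cases hg : g = cs.simple i
    · exact .inl hg
    · rw [if_neg hg, zero_add] at h
      exact .inr ⟨_, ih _ h, by simp [MulAut.conj_apply, mul_assoc]⟩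

theorem length_mul_lt_of_leftParity_ne_zero {w g : W} (h : cs.leftParity w g ≠ 0) :
    cs.length (g * w) < cs.length w := by
  obtain ⟨ω, hω, rfl⟩ := cs.exists_isReduced w
  exact (cs.isLeftInversion_of_mem_leftInvSeq hω
    (cs.mem_leftInvSeq_of_leftParity_ne_zero ω g h)).2

theorem IsReflection.leftParity_self {cs : CoxeterSystem M W} {t : W} (ht : cs.IsReflection t) :
    cs.leftParity t t = 1 := by
  classical
  obtain ⟨w, i, rfl⟩ := ht
  have h : cs.leftParity (w * w⁻¹) (w * cs.simple i * w⁻¹) = 0 := by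
    rw [mul_inv_cancel, leftParity_one]
  rw [leftParity_mul] at h
  rw [leftParity_mul, leftParity_mul, leftParity_simple]
  simp only [mul_assoc, inv_mul_cancel_left, inv_mul_cancel, mul_one, mul_inv_rev, inv_simple,
    simple_mul_simple_self, if_true] at h ⊢
  linear_combination h

theorem IsReflection.leftParity_ne_zero {cs : CoxeterSystem M W} {w t : W}
    (ht : cs.IsReflection t) (h : cs.length (t * w) < cs.length w) : cs.leftParity w t ≠ 0 := by
  intro h0
  have h1 : cs.leftParity (t * w) t ≠ 0 := by
    simp [leftParity_mul, ht.leftParity_self, h0]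
  have h2 := cs.length_mul_lt_of_leftParity_ne_zero h1
  rw [← mul_assoc, ht.mul_self, one_mul] at h2
  omega

theorem IsReflection.leftParity_ne_zero_or {cs : CoxeterSystem M W} {t a y : W}
    (ht : cs.IsReflection t) (h : cs.length (t * (a * y)) < cs.length (a * y)) :
    cs.leftParity a t ≠ 0 ∨ cs.length (a⁻¹ * t * a * y) < cs.length y := by
  have h1 := ht.leftParity_ne_zero h
  rw [leftParity_mul] at h1
  by_cases h2 : cs.leftParity a t = 0
  · rw [h2, zero_add] at h1
    exact .inr (cs.length_mul_lt_of_leftParity_ne_zero h1)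
  · exact .inl h2

/-! ### The right weak order -/

/-- The right weak order: `u` is a left factor of `w`. -/
def WeakLE (u w : W) : Prop := cs.length u + cs.length (u⁻¹ * w) = cs.length w

variable {cs}

theorem length_le_add (cs : CoxeterSystem M W) (u w : W) :
    cs.length w ≤ cs.length u + cs.length (u⁻¹ * w) := by
  simpa using cs.length_mul_le u (u⁻¹ * w)

theorem WeakLE.trans {u v w : W} (h₁ : cs.WeakLE u v) (h₂ : cs.WeakLE v w) : cs.WeakLE u w := by
  have h3 := cs.length_mul_le (u⁻¹ * v) (v⁻¹ * w)
  rw [mul_assoc, mul_inv_cancel_left] at h3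
  have h4 := cs.length_le_add u w
  unfold WeakLE at *
  omega

theorem WeakLE.antisymm {u v : W} (h₁ : cs.WeakLE u v) (h₂ : cs.WeakLE v u) : u = v := by
  unfold WeakLE at *
  have : cs.length (u⁻¹ * v) = 0 := by omega
  rwa [length_eq_zero_iff, inv_mul_eq_one] at this

theorem one_weakLE (w : W) : cs.WeakLE 1 w := by simp [WeakLE]

theorem weakLE_mul_iff {u v : W} :
    cs.WeakLE u (u * v) ↔ cs.length (u * v) = cs.length u + cs.length v := by
  rw [WeakLE, inv_mul_cancel_left, eq_comm]

theorem WeakLE.inv_mul_iff {a u w : W} (hu : cs.WeakLE a u) (hw : cs.WeakLE a w) :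
    cs.WeakLE (a⁻¹ * u) (a⁻¹ * w) ↔ cs.WeakLE u w := by
  unfold WeakLE at *
  rw [mul_inv_rev, inv_inv, mul_assoc, mul_inv_cancel_left]
  omega

theorem simple_weakLE_iff {i : B} {w : W} :
    cs.WeakLE (cs.simple i) w ↔ cs.IsLeftDescent w i := by
  rw [WeakLE, isLeftDescent_iff, length_simple, inv_simple, add_comm]

/-- The alternating product `s i * s j * s i * ⋯` with `k` factors. -/
noncomputable def altProd (cs : CoxeterSystem M W) : B → B → ℕ → W
  | _, _, 0 => 1
  | i, j, k + 1 => cs.simple i * altProd cs j i k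

theorem length_altProd_le (i j : B) (k : ℕ) : cs.length (cs.altProd i j k) ≤ k := by
  induction k generalizing i j with
  | zero => simp [altProd]
  | succ k ih =>
    have := cs.length_mul_le (cs.simple i) (cs.altProd j i k)
    have := ih j i
    have := cs.length_simple i
    rw [altProd]
    omega

theorem altProd_eq (i j : B) (k : ℕ) :
    cs.altProd i j k = (cs.simple i * cs.simple j) ^ k * cs.altProd j i k := by
  induction k generalizing i j with
  | zero => simp [altProd]
  | succ k ih =>
    rw [altProd, altProd, ih j i, pow_succ]
    have : SemiconjBy (cs.simple i) (cs.simple j * cs.simple i) (cs.simple i * cs.simple j) := by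
      simp [SemiconjBy, mul_assoc]
    rw [← mul_assoc, (this.pow_right k).eq]
    simp [mul_assoc]

theorem exists_of_leftParity_altProd_ne_zero {i j : B} {k : ℕ} {g : W}
    (h : cs.leftParity (cs.altProd i j k) g ≠ 0) :
    ∃ n < k, g = (cs.simple i * cs.simple j) ^ n * cs.simple i := by
  classical
  induction k generalizing i j g with
  | zero => simp [altProd, leftParity_one] at h
  | succ k ih =>
    rw [altProd, leftParity_mul, leftParity_simple] at h
    by_cases hg : g = cs.simple i
    · exact ⟨0, by omega, by simpa using hg⟩
    · rw [if_neg hg, zero_add] at h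
      obtain ⟨n, hn, hg⟩ := ih h
      refine ⟨n + 1, by omega, ?_⟩
      have : SemiconjBy (cs.simple i) (cs.simple j * cs.simple i) (cs.simple i * cs.simple j) := by
        simp [SemiconjBy, mul_assoc]
      have h2 : g = cs.simple i * (((cs.simple j * cs.simple i) ^ n) * cs.simple j)
          * cs.simple i := by
        rw [← hg]
        simp [mul_assoc]
      rw [h2, ← mul_assoc, (this.pow_right n).eq, pow_succ]
      simp [mul_assoc]

theorem length_altProd_add {i j : B} {x : W} (hi : cs.WeakLE (cs.simple i) x)
    (hj : cs.WeakLE (cs.simple j) x) {k : ℕ} (hk : k ≤ orderOf (cs.simple i * cs.simple j)) :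
    k + cs.length ((cs.altProd i j k)⁻¹ * x) = cs.length x := by
  induction k generalizing i j with
  | zero => simp [altProd]
  | succ k ih =>
    have ho : orderOf (cs.simple j * cs.simple i) = orderOf (cs.simple i * cs.simple j) := by
      rw [← orderOf_inv]
      simp
    have h := ih hj hi (by omega)
    have hx : cs.altProd j i k * ((cs.altProd j i k)⁻¹ * x) = x := mul_inv_cancel_left _ _
    have hd : cs.length (cs.simple i * (cs.altProd j i k * ((cs.altProd j i k)⁻¹ * x))) <
        cs.length (cs.altProd j i k * ((cs.altProd j i k)⁻¹ * x)) := by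
      rw [hx]
      exact simple_weakLE_iff.1 hi
    rcases (cs.isReflection_simple i).leftParity_ne_zero_or hd with h1 | h1
    · obtain ⟨n, hn, hg⟩ := exists_of_leftParity_altProd_ne_zero h1
      have : (cs.simple j * cs.simple i) ^ (n + 1) = 1 := by
        rw [pow_succ, ← mul_assoc, ← hg, simple_mul_simple_self]
      have := orderOf_le_of_pow_eq_one (Nat.succ_pos n) this
      omega
    · have h2 : (cs.altProd i j (k + 1))⁻¹ * x =
          (cs.altProd j i k)⁻¹ * cs.simple i * cs.altProd j i k * ((cs.altProd j i k)⁻¹ * x) := by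
        simp [altProd, mul_assoc]
      rw [← h2] at h1
      have h3 := cs.length_le_add (cs.altProd i j (k + 1)) x
      have := length_altProd_le (cs := cs) i j (k + 1)
      omega

theorem exists_join_simple [Finite W] (cs : CoxeterSystem M W) (i j : B) (x : W)
    (hi : cs.WeakLE (cs.simple i) x) (hj : cs.WeakLE (cs.simple j) x) :
    ∃ u, cs.WeakLE (cs.simple i) u ∧ cs.WeakLE (cs.simple j) u ∧
      ∀ y, cs.WeakLE (cs.simple i) y → cs.WeakLE (cs.simple j) y → cs.WeakLE u y := by
  set m := orderOf (cs.simple i * cs.simple j) with hm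
  obtain ⟨k, hk⟩ : ∃ k, m = k + 1 := Nat.exists_eq_succ_of_ne_zero (orderOf_pos _).ne'
  have hle := length_altProd_le (cs := cs) i j m
  have hlen : cs.length (cs.altProd i j m) = m := by
    have h1 := length_altProd_add hi hj le_rfl
    have h2 := cs.length_le_add (cs.altProd i j m) x
    rw [← hm] at h1
    omega
  have hdesc : ∀ i j, cs.length (cs.altProd i j m) = m →
      cs.WeakLE (cs.simple i) (cs.altProd i j m) := by
    intro i j h
    rw [simple_weakLE_iff, IsLeftDescent, h, hk, altProd, simple_mul_simple_cancel_left]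
    exact Nat.lt_succ_of_le (length_altProd_le j i k)
  have heq : cs.altProd i j m = cs.altProd j i m := by
    rw [altProd_eq, pow_orderOf_eq_one, one_mul]
  refine ⟨cs.altProd i j m, hdesc i j hlen, heq ▸ hdesc j i (heq ▸ hlen), fun y h₁ h₂ => ?_⟩
  rw [WeakLE, hlen]
  exact length_altProd_add h₁ h₂ le_rfl

theorem exists_meet [Finite W] (cs : CoxeterSystem M W) (x y : W) :
    ∃ z, cs.WeakLE z x ∧ cs.WeakLE z y ∧ ∀ u, cs.WeakLE u x → cs.WeakLE u y → cs.WeakLE u z := by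
  induction hn : cs.length x using Nat.strong_induction_on generalizing x y with
  | _ n ih =>
  subst hn
  have key : ∀ i, cs.WeakLE (cs.simple i) x → cs.WeakLE (cs.simple i) y →
      ∃ z, cs.WeakLE (cs.simple i) z ∧ cs.WeakLE z x ∧ cs.WeakLE z y ∧
        ∀ u, cs.WeakLE (cs.simple i) u → cs.WeakLE u x → cs.WeakLE u y → cs.WeakLE u z := by
    intro i hx hy
    obtain ⟨z, hzx, hzy, hz⟩ := ih _ (simple_weakLE_iff.1 hx) (cs.simple i * x)
      (cs.simple i * y) rfl
    have hi : cs.WeakLE (cs.simple i) (cs.simple i * z) := by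
      have h1 := cs.length_le_add z (cs.simple i * x)
      have h2 := cs.length_mul_le (cs.simple i * z) (z⁻¹ * (cs.simple i * x))
      have h3 : cs.simple i * z * (z⁻¹ * (cs.simple i * x)) = x := by simp [mul_assoc]
      have h4 := cs.length_mul_le (cs.simple i) z
      rw [h3] at h2
      rw [weakLE_mul_iff, length_simple]
      unfold WeakLE at hx hzx
      rw [length_simple, inv_simple] at hx
      rw [length_simple] at h4
      omega
    have hz' : z = (cs.simple i)⁻¹ * (cs.simple i * z) := by simp
    refine ⟨cs.simple i * z, hi, (hi.inv_mul_iff hx).1 ?_, (hi.inv_mul_iff hy).1 ?_,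
      fun u hu hux huy => (hu.inv_mul_iff hi).1 ?_⟩
    · simpa using hzx
    · simpa using hzy
    · rw [inv_mul_cancel_left]
      apply hz
      · simpa using (hu.inv_mul_iff hx).2 hux
      · simpa using (hu.inv_mul_iff hy).2 huy
  by_cases h : ∃ i, cs.WeakLE (cs.simple i) x ∧ cs.WeakLE (cs.simple i) y
  · obtain ⟨i, hix, hiy⟩ := h
    obtain ⟨z, hiz, hzx, hzy, hz⟩ := key i hix hiy
    refine ⟨z, hzx, hzy, fun u hux huy => ?_⟩
    by_cases hu : u = 1
    · exact hu.symm ▸ one_weakLE z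
    obtain ⟨j, hj⟩ := cs.exists_leftDescent_of_ne_one hu
    rw [← simple_weakLE_iff] at hj
    obtain ⟨z', hjz', hzx', hzy', hz'⟩ := key j (hj.trans hux) (hj.trans huy)
    obtain ⟨v, hiv, hjv, hv⟩ := cs.exists_join_simple i j x hix (hj.trans hux)
    have hvz' : cs.WeakLE v z' :=
      hz' v hjv (hv x hix (hj.trans hux)) (hv y hiy (hj.trans huy))
    exact (hz' u hj hux huy).trans (hz z' (hiv.trans hvz') hzx' hzy')
  · refine ⟨1, one_weakLE x, one_weakLE y, fun u hux huy => ?_⟩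
    by_cases hu : u = 1
    · exact hu.symm ▸ one_weakLE 1
    obtain ⟨j, hj⟩ := cs.exists_leftDescent_of_ne_one hu
    rw [← simple_weakLE_iff] at hj
    exact (h ⟨j, hj.trans hux, hj.trans huy⟩).elim

theorem exists_longest [Finite W] (cs : CoxeterSystem M W) : ∃ w₀, ∀ w, cs.WeakLE w w₀ := by
  obtain ⟨w₀, h₀⟩ := Finite.exists_max cs.length
  refine ⟨w₀, fun w => ?_⟩
  induction w using cs.simple_induction_right with
  | one => exact one_weakLE w₀
  | mul_simple_right w i ih =>
    have h1 := cs.length_le_add (w * cs.simple i) w₀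
    have h2 := cs.length_simple_mul (w⁻¹ * w₀) i
    unfold WeakLE at *
    rw [mul_inv_rev, inv_simple, mul_assoc] at *
    rcases cs.length_mul_simple w i with h | h
    · have ht : cs.IsReflection (w * cs.simple i * w⁻¹) := ⟨w, i, rfl⟩
      have hlt : cs.length (w * cs.simple i * w⁻¹ * (w * (w⁻¹ * w₀))) <
          cs.length (w * (w⁻¹ * w₀)) := by
        rw [mul_inv_cancel_left]
        exact lt_of_le_of_ne (h₀ _) (ht.length_mul_right_ne w₀)
      rcases ht.leftParity_ne_zero_or hlt with h3 | h3
      · have := cs.length_mul_lt_of_leftParity_ne_zero h3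
        rw [inv_mul_cancel_right] at this
        omega
      · have h4 : w⁻¹ * (w * cs.simple i * w⁻¹) * w * (w⁻¹ * w₀) = cs.simple i * (w⁻¹ * w₀) := by
          simp [mul_assoc]
        rw [h4] at h3
        omega
    · omega

/-! ### The greatest simple divisor of a product of two simple elements -/

theorem exists_greatest_factor [Finite W] (cs : CoxeterSystem M W) (x y : W) :
    ∃ z, cs.WeakLE z y ∧ cs.length (x * z) = cs.length x + cs.length z ∧
      ∀ u, cs.WeakLE u y → cs.length (x * u) = cs.length x + cs.length u → cs.WeakLE u z := by
  obtain ⟨w₀, h₀⟩ := cs.exists_longest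
  have key : ∀ z, cs.WeakLE z (x⁻¹ * w₀) ↔ cs.length (x * z) = cs.length x + cs.length z := by
    intro z
    have h1 := h₀ x
    have h2 := h₀ (x * z)
    unfold WeakLE at *
    rw [mul_inv_rev, mul_assoc] at h2
    omega
  simpa only [key, and_assoc] using cs.exists_meet y (x⁻¹ * w₀)

/-- The greatest left factor `z` of `y` such that `x * z` is length-additive. -/
noncomputable def greatestFactor [Finite W] (cs : CoxeterSystem M W) (x y : W) : W :=
  (cs.exists_greatest_factor x y).choose

section

variable [Finite W]

theorem greatestFactor_weakLE (x y : W) : cs.WeakLE (cs.greatestFactor x y) y :=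
  (cs.exists_greatest_factor x y).choose_spec.1

theorem length_mul_greatestFactor (x y : W) : cs.length (x * cs.greatestFactor x y) =
    cs.length x + cs.length (cs.greatestFactor x y) :=
  (cs.exists_greatest_factor x y).choose_spec.2.1

theorem weakLE_greatestFactor {x y u : W} (hu : cs.WeakLE u y)
    (h : cs.length (x * u) = cs.length x + cs.length u) : cs.WeakLE u (cs.greatestFactor x y) :=
  (cs.exists_greatest_factor x y).choose_spec.2.2 u hu h

theorem mul_greatestFactor_mul {x y : W} (h : cs.length (x * y) = cs.length x + cs.length y)
    (w : W) : x * y * cs.greatestFactor (x * y) w =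
      x * cs.greatestFactor x (y * cs.greatestFactor y w) := by
  set z := cs.greatestFactor y w
  have hyz : cs.WeakLE y (y * z) := weakLE_mul_iff.2 (length_mul_greatestFactor y w)
  set u := cs.greatestFactor x (y * z) with hu
  have hyu : cs.WeakLE y u := weakLE_greatestFactor hyz h
  set v := cs.greatestFactor (x * y) w with hv
  have hxyv := cs.length_mul_greatestFactor (x * y) w
  rw [← hv] at hxyv
  have hyv : cs.length (y * v) = cs.length y + cs.length v := by
    have h1 := cs.length_mul_le x (y * v)
    have h2 := cs.length_mul_le y v
    rw [← mul_assoc] at h1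
    omega
  rw [mul_assoc]
  congr 1
  apply WeakLE.antisymm (cs := cs)
  · apply weakLE_greatestFactor
    · refine ((weakLE_mul_iff.2 hyv).inv_mul_iff hyz).1 ?_
      rw [inv_mul_cancel_left, inv_mul_cancel_left]
      exact weakLE_greatestFactor (greatestFactor_weakLE _ _) hyv
    · rw [← mul_assoc]
      omega
  · refine (hyu.inv_mul_iff (weakLE_mul_iff.2 hyv)).1 ?_
    rw [inv_mul_cancel_left]
    apply weakLE_greatestFactor
    · have h1 := (hyu.inv_mul_iff hyz).2 (greatestFactor_weakLE x (y * z))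
      rw [inv_mul_cancel_left] at h1
      exact h1.trans (greatestFactor_weakLE _ _)
    · have h1 := cs.length_mul_greatestFactor x (y * z)
      rw [← hu] at h1
      rw [mul_assoc, mul_inv_cancel_left]
      unfold WeakLE at hyu
      omega

end

end CoxeterSystem

namespace BraidMonoid

open CoxeterSystem

variable {cs : CoxeterSystem M W}

theorem induction_on {p : BraidMonoid cs → Prop} (b : BraidMonoid cs) (one : p 1)
    (mul : ∀ w c, p c → p (bOf cs w * c)) : p b := by
  obtain ⟨ω, rfl⟩ := PresentedMonoid.surjective_mk b
  induction ω using FreeMonoid.inductionOn' with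
  | one => exact one
  | of_mul w ω ih => exact mul w _ ih

theorem bOf_mul {u v : W} (h : cs.length (u * v) = cs.length u + cs.length v) :
    bOf cs u * bOf cs v = bOf cs (u * v) :=
  PresentedMonoid.mk_eq_mk_of_rel ⟨u, v, h, rfl, rfl⟩

theorem bOf_one_mul_bOf (w : W) : bOf cs 1 * bOf cs w = bOf cs w := by
  rw [bOf_mul (by simp), one_mul]

theorem bOf_one_mul {b : BraidMonoid cs} (hb : b ≠ 1) : bOf cs 1 * b = b := by
  induction b using induction_on with
  | one => exact (hb rfl).elim
  | mul w c _ => rw [← mul_assoc, bOf_one_mul_bOf]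

theorem bOf_mul_of_weakLE {u v : W} (h : cs.WeakLE u v) :
    bOf cs u * bOf cs (u⁻¹ * v) = bOf cs v := by
  rw [bOf_mul, mul_inv_cancel_left]
  rw [mul_inv_cancel_left]
  exact h.symm

theorem bPi_bOf (w : W) : bPi cs (bOf cs w) = w := rfl

theorem bLen_bOf (w : W) : bLen cs (bOf cs w) = Multiplicative.ofAdd (cs.length w) := rfl

theorem bOf_mem_bW (w : W) : bOf cs w ∈ bW cs := rfl

theorem bOf_mul_ne_one (w : W) (z : BraidMonoid cs) : bOf cs w * z ≠ 1 := by
  intro h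
  let φ : BraidMonoid cs →* ℕ := PresentedMonoid.lift (fun _ : W => 0) (by
    rintro a b ⟨w₁, w₂, -, rfl, rfl⟩
    simp)
  have h1 := congrArg φ h
  rw [map_mul, map_one, show φ (bOf cs w) = 0 from rfl, zero_mul] at h1
  exact zero_ne_one h1

theorem length_bPi_le (b : BraidMonoid cs) : cs.length (bPi cs b) ≤ (bLen cs b).toAdd := by
  induction b using induction_on with
  | one => simp
  | mul w c ih =>
    have := cs.length_mul_le w (bPi cs c)
    rw [map_mul, map_mul, bPi_bOf, bLen_bOf, toAdd_mul, toAdd_ofAdd]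
    omega

theorem eq_one_or_eq_bOf_of_mem_bW {b : BraidMonoid cs} (hb : b ∈ bW cs) :
    b = 1 ∨ ∃ w, b = bOf cs w := by
  induction b using induction_on with
  | one => exact .inl rfl
  | mul w c ih =>
    right
    have h1 := cs.length_mul_le w (bPi cs c)
    have h2 := length_bPi_le c
    have h3 := congrArg Multiplicative.toAdd hb
    rw [map_mul (bLen cs), map_mul (bPi cs), bPi_bOf, bLen_bOf, toAdd_mul, toAdd_ofAdd,
      toAdd_ofAdd] at h3
    have hc : c ∈ bW cs := Multiplicative.toAdd.injective (by rw [toAdd_ofAdd]; omega)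
    rcases ih hc with rfl | ⟨v, rfl⟩
    · exact ⟨w, mul_one _⟩
    · exact ⟨w * v, bOf_mul h3.symm⟩

theorem eq_of_bOf_dvd_bOf {u v : W} {y z : BraidMonoid cs} (hy : bOf cs u * y = bOf cs v)
    (hz : bOf cs v * z = bOf cs u) : u = v := by
  have h1 := congrArg (fun b => (bLen cs b).toAdd) hy
  have h2 := congrArg (fun b => (bLen cs b).toAdd) hz
  simp only [map_mul, bLen_bOf, toAdd_mul, toAdd_ofAdd] at h1 h2
  have h3 := length_bPi_le y
  have h4 : bPi cs y = 1 := cs.length_eq_zero_iff.1 (by omega)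
  have h5 := congrArg (bPi cs) hy
  rwa [map_mul, bPi_bOf, bPi_bOf, h4, mul_one] at h5

/-- The product of `x` and the greatest left factor of the argument that it can be multiplied with
length-additively. -/
noncomputable def headStep [Finite W] (cs : CoxeterSystem M W) (x : W) : Function.End W :=
  fun y => x * cs.greatestFactor x y

/-- The action of `B⁺` on `W` under which `b` sends `w` to the greatest simple left divisor of
the product of `b` and the lift of `w`. -/
noncomputable def headAction [Finite W] (cs : CoxeterSystem M W) :
    BraidMonoid cs →* Function.End W :=
  PresentedMonoid.lift (headStep cs) (by
    rintro a b ⟨x, y, h, rfl, rfl⟩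
    simp only [map_mul, FreeMonoid.lift_eval_of]
    funext w
    exact (mul_greatestFactor_mul h w).symm)

/-- The element of `W` underlying the greatest simple left divisor of `b`. -/
noncomputable def head [Finite W] (b : BraidMonoid cs) : W := headAction cs b 1

variable [Finite W]

theorem head_bOf_mul (w : W) (c : BraidMonoid cs) :
    head (bOf cs w * c) = w * cs.greatestFactor w (head c) := by
  rw [head, map_mul]
  rfl

theorem bOf_head_dvd (b : BraidMonoid cs) : ∃ z, bOf cs (head b) * z = bOf cs 1 * b := by
  induction b using induction_on with
  | one => exact ⟨1, rfl⟩
  | mul w c ih =>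
    obtain ⟨z, hz⟩ := ih
    set u := cs.greatestFactor w (head c) with hu
    refine ⟨bOf cs (u⁻¹ * head c) * z, ?_⟩
    rw [head_bOf_mul, ← bOf_mul (length_mul_greatestFactor w (head c)), ← hu, ← mul_assoc,
      mul_assoc (bOf cs w), bOf_mul_of_weakLE (greatestFactor_weakLE w (head c)), mul_assoc, hz,
      ← mul_assoc, ← mul_assoc, bOf_one_mul_bOf, bOf_mul (by simp), mul_one]

theorem bOf_dvd_bOf_head (w : W) (c : BraidMonoid cs) :
    ∃ z, bOf cs w * z = bOf cs (head (bOf cs w * c)) :=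
  ⟨_, by rw [head_bOf_mul]; exact bOf_mul (length_mul_greatestFactor w (head c))⟩

end BraidMonoid

/-- Every element `b` of `B⁺` has a unique maximal left divisor
belonging to `𝐖`. -/
theorem stmt7 [Finite W] (cs : CoxeterSystem M W) (b : BraidMonoid cs) :
    ∃! a : BraidMonoid cs, a ∈ bW cs ∧ (∃ z, a * z = b) ∧
      ∀ c ∈ bW cs, (∃ z, c * z = b) → ∃ z, c * z = a := by
  by_cases hb : b = 1
  · subst hb
    have hdvd : ∀ c ∈ bW cs, (∃ z, c * z = 1) → c = 1 := by
      rintro c hc ⟨z, hz⟩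
      rcases BraidMonoid.eq_one_or_eq_bOf_of_mem_bW hc with rfl | ⟨w, rfl⟩
      · rfl
      · exact (BraidMonoid.bOf_mul_ne_one w z hz).elim
    exact ⟨1, ⟨by simp [bW], ⟨1, mul_one 1⟩, fun c hc h => ⟨1, by rw [hdvd c hc h, mul_one]⟩⟩,
      fun a ha => hdvd a ha.1 ha.2.1⟩
  have hhead : ∃ z, bOf cs (BraidMonoid.head b) * z = b := by
    simpa only [BraidMonoid.bOf_one_mul hb] using BraidMonoid.bOf_head_dvd b
  have hmax : ∀ c ∈ bW cs, (∃ z, c * z = b) → ∃ z, c * z = bOf cs (BraidMonoid.head b) := by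
    rintro c hc ⟨z, rfl⟩
    rcases BraidMonoid.eq_one_or_eq_bOf_of_mem_bW hc with rfl | ⟨w, rfl⟩
    · exact ⟨_, one_mul _⟩
    · exact BraidMonoid.bOf_dvd_bOf_head w z
  refine ⟨bOf cs (BraidMonoid.head b), ⟨BraidMonoid.bOf_mem_bW _, hhead, hmax⟩, ?_⟩
  rintro a ⟨ha, hab, hmax'⟩
  obtain ⟨y, hy⟩ := hmax a ha hab
  obtain ⟨z, hz⟩ := hmax' _ (BraidMonoid.bOf_mem_bW _) hhead
  rcases BraidMonoid.eq_one_or_eq_bOf_of_mem_bW ha with rfl | ⟨w, rfl⟩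
  · exact (BraidMonoid.bOf_mul_ne_one _ _ hz).elim
  · rw [BraidMonoid.eq_of_bOf_dvd_bOf hy hz]
end

section
/- Let I ⊆ S, let w ∈ W be such that l(ws) > l(w) for all s ∈ I (equivalently, l(wv) = l(w) + l(v) for all v ∈ W_I), let w′ ∈ W_I, and let v ∈ W with v ≤ ww′. If w ≤ v, then v = w·w′₁ for some w′₁ ≤ w′. If w ≰ v, then v = w₁·w′₁ for some w₁ < w and w′₁ ≤ w′ with l(w₁w′₁) = l(w₁) + l(w′₁). -/
variable {B : Type*} {W : Type*} [Group W] {M : CoxeterMatrix B}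

/-- The Bruhat order on `W`: `v ≤ w` iff some (equivalently, every) reduced expression
of `w` has a subsequence with product `v`. -/
def bruhatLE (cs : CoxeterSystem M W) (v w : W) : Prop :=
  ∃ ω : List B, cs.wordProd ω = w ∧ ω.length = cs.length w ∧
    ∃ ω' : List B, ω'.Sublist ω ∧ cs.wordProd ω' = v

namespace CoxeterSystem

variable (cs : CoxeterSystem M W)

open Classical in
/-- The action of a simple reflection on pairs `(t, ε)`: conjugate `t` by the simple reflection and
flip the sign `ε` when `t` equals it. -/
noncomputable def signedConjPerm (i : B) : Equiv.Perm (W × ZMod 2) :=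
  Function.Involutive.toPerm
    (fun p => (cs.simple i * p.1 * cs.simple i, p.2 + if p.1 = cs.simple i then 1 else 0)) (by
      rintro ⟨t, ε⟩
      have h : cs.simple i * t * cs.simple i = cs.simple i ↔ t = cs.simple i := by
        constructor
        · intro h
          have h' := congrArg (fun x => cs.simple i * x * cs.simple i) h
          simpa [mul_assoc] using h'
        · rintro rfl
          simp
      ext
      · simp [mul_assoc]
      · by_cases ht : t = cs.simple i
        · simp [ht, add_assoc, CharTwo.add_self_eq_zero]
        · simp [h, ht])

open Classical in
theorem signedConjPerm_apply (i : B) (p : W × ZMod 2) :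
    cs.signedConjPerm i p =
      (cs.simple i * p.1 * cs.simple i, p.2 + if p.1 = cs.simple i then 1 else 0) := rfl

open Classical in
theorem prod_map_signedConjPerm_apply (ω : List B) (p : W × ZMod 2) :
    (ω.map cs.signedConjPerm).prod p =
      (cs.wordProd ω * p.1 * (cs.wordProd ω)⁻¹, p.2 + ((cs.rightInvSeq ω).count p.1 : ℕ)) := by
  induction ω with
  | nil => simp
  | cons i ω ih =>
    have h : cs.wordProd ω * p.1 * (cs.wordProd ω)⁻¹ = cs.simple i ↔
        (cs.wordProd ω)⁻¹ * cs.simple i * cs.wordProd ω = p.1 := by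
      constructor
      · intro h
        rw [← h]
        group
      · intro h
        rw [← h]
        group
    rw [List.map_cons, List.prod_cons, Equiv.Perm.mul_apply, ih, signedConjPerm_apply]
    ext
    · simp [wordProd_cons, mul_assoc]
    · simp only [h, rightInvSeq, List.count_cons, beq_iff_eq]
      split_ifs <;> simp [add_assoc]

theorem prod_map_alternatingWord {G : Type*} [Monoid G] (f : B → G) (i j : B) (m : ℕ) :
    ((alternatingWord i j (2 * m)).map f).prod = (f i * f j) ^ m := by
  induction m with
  | zero => simp [alternatingWord]
  | succ m ih =>
    rw [show 2 * (m + 1) = 2 * m + 1 + 1 by ring, alternatingWord_succ, alternatingWord_succ,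
      pow_succ, ← ih]
    simp

open Classical in
theorem even_count_leftInvSeq_alternatingWord (i j : B) (t : W) :
    Even ((cs.leftInvSeq (alternatingWord i j (2 * M i j))).count t) := by
  set L := cs.leftInvSeq (alternatingWord i j (2 * M i j)) with hL
  have hlen : L.length = 2 * M i j := by simp [hL]
  have hper : L.drop (M i j) = L.take (M i j) := by
    apply List.ext_getElem
    · simp [hlen]
      omega
    · intro k h₁ h₂
      have hk : k < M i j := by
        simp only [List.length_take, lt_inf_iff] at h₂
        exact h₂.1
      rw [List.getElem_drop, List.getElem_take]
      simp only [hL]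
      rw [getElem_leftInvSeq_alternatingWord cs i j _ _ (by omega),
        getElem_leftInvSeq_alternatingWord cs i j _ _ (by omega),
        prod_alternatingWord_eq_mul_pow, prod_alternatingWord_eq_mul_pow,
        show (2 * (M i j + k) + 1) / 2 = M i j + k by omega, show (2 * k + 1) / 2 = k by omega,
        pow_add, simple_mul_simple_pow']
      simp
  rw [← List.take_append_drop (M i j) L, List.count_append, hper]
  exact ⟨_, rfl⟩

theorem isLiftable_signedConjPerm : M.IsLiftable cs.signedConjPerm := by
  classical
  intro i j
  rw [← prod_map_alternatingWord]
  have hinv : ((alternatingWord i j (2 * M i j)).map cs.signedConjPerm).prod⁻¹ =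
      ((alternatingWord i j (2 * M i j)).reverse.map cs.signedConjPerm).prod := by
    rw [List.prod_inv_reverse, List.map_map, List.map_reverse]
    congr 3
  rw [← inv_eq_one, hinv]
  ext1 p
  rw [prod_map_signedConjPerm_apply, rightInvSeq_reverse, List.count_reverse,
    (ZMod.natCast_eq_zero_iff_even).2 (cs.even_count_leftInvSeq_alternatingWord i j p.1)]
  have hone : cs.wordProd (alternatingWord i j (2 * M i j)) = 1 := by
    rw [wordProd, prod_map_alternatingWord, simple_mul_simple_pow]
  simp [hone]

/-- The action of `W` on pairs `(t, ε)` extending `signedConjPerm`. -/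
noncomputable def signedConj : W →* Equiv.Perm (W × ZMod 2) :=
  cs.lift ⟨cs.signedConjPerm, cs.isLiftable_signedConjPerm⟩

open Classical in
theorem signedConj_wordProd_apply (ω : List B) (p : W × ZMod 2) :
    cs.signedConj (cs.wordProd ω) p =
      (cs.wordProd ω * p.1 * (cs.wordProd ω)⁻¹, p.2 + ((cs.rightInvSeq ω).count p.1 : ℕ)) := by
  rw [← prod_map_signedConjPerm_apply, wordProd, map_list_prod, List.map_map]
  congr 3
  funext i
  exact cs.lift_apply_simple cs.isLiftable_signedConjPerm i

theorem signedConj_apply (w : W) (p : W × ZMod 2) :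
    cs.signedConj w p = (w * p.1 * w⁻¹, p.2 + (cs.signedConj w (p.1, 0)).2) := by
  classical
  obtain ⟨ω, -, rfl⟩ := cs.exists_isReduced w
  simp [signedConj_wordProd_apply]

theorem IsReflection.signedConj_apply_self {cs : CoxeterSystem M W} {t : W}
    (ht : cs.IsReflection t) : (cs.signedConj t (t, 0)).2 = 1 := by
  obtain ⟨u, i, rfl⟩ := ht
  have hs : ∀ ε : ZMod 2, cs.signedConj (cs.simple i) (cs.simple i, ε) =
      (cs.simple i, ε + 1) := by
    classical
    intro ε
    have h := cs.signedConj_wordProd_apply [i] (cs.simple i, ε)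
    simpa using h
  have hu : cs.signedConj u⁻¹ (u * cs.simple i * u⁻¹, 0) =
      (cs.simple i, (cs.signedConj u⁻¹ (u * cs.simple i * u⁻¹, 0)).2) := by
    rw [signedConj_apply]
    simp [mul_assoc]
  set a := (cs.signedConj u⁻¹ (u * cs.simple i * u⁻¹, 0)).2
  have hu' : cs.signedConj u (cs.simple i, a) = (u * cs.simple i * u⁻¹, 0) := by
    rw [← hu, ← Equiv.Perm.mul_apply, ← map_mul]
    simp
  rw [signedConj_apply] at hu'
  have ha := congrArg Prod.snd hu'
  rw [map_mul, map_mul, Equiv.Perm.mul_apply, Equiv.Perm.mul_apply, hu, hs, signedConj_apply]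
  simp only at ha ⊢
  rw [add_right_comm, ha, zero_add]

theorem mem_rightInvSeq_of_signedConj_ne_zero {ω : List B} {t : W}
    (h : (cs.signedConj (cs.wordProd ω) (t, 0)).2 ≠ 0) : t ∈ cs.rightInvSeq ω := by
  classical
  by_contra hmem
  apply h
  simp [signedConj_wordProd_apply, List.count_eq_zero_of_not_mem hmem]

/-- Every right inversion of the product of a word occurs in its right inversion sequence. -/
theorem IsRightInversion.mem_rightInvSeq {cs : CoxeterSystem M W} {ω : List B} {t : W}
    (h : cs.IsRightInversion (cs.wordProd ω) t) : t ∈ cs.rightInvSeq ω := by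
  apply mem_rightInvSeq_of_signedConj_ne_zero
  intro hzero
  obtain ⟨τ, hτ, hprod⟩ := cs.exists_isReduced (cs.wordProd ω * t)
  have hmem : t ∈ cs.rightInvSeq τ := by
    apply mem_rightInvSeq_of_signedConj_ne_zero
    have ht := h.1.signedConj_apply_self
    rw [← hprod, map_mul, Equiv.Perm.mul_apply, signedConj_apply, ht, signedConj_apply cs t]
    simp [hzero]
  have hinv := cs.isRightInversion_of_mem_rightInvSeq hτ hmem
  rw [← hprod] at hinv
  exact (h.1.isRightInversion_mul_left_iff.1 hinv) h

/-- The strong exchange property. -/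
theorem IsRightInversion.exists_eraseIdx {cs : CoxeterSystem M W} {ω : List B} {t : W}
    (h : cs.IsRightInversion (cs.wordProd ω) t) :
    ∃ k < ω.length, cs.wordProd ω * t = cs.wordProd (ω.eraseIdx k) := by
  obtain ⟨k, hk, hkt⟩ := List.mem_iff_getElem.1 h.mem_rightInvSeq
  refine ⟨k, by simpa using hk, ?_⟩
  rw [← wordProd_mul_getD_rightInvSeq, List.getD_eq_getElem _ _ hk, hkt]

/-- The deletion property. -/
theorem exists_isReduced_sublist (ω : List B) :
    ∃ τ : List B, τ.Sublist ω ∧ cs.IsReduced τ ∧ cs.wordProd τ = cs.wordProd ω := by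
  induction ω using List.reverseRecOn with
  | nil => exact ⟨[], List.Sublist.refl _, by simp [IsReduced], rfl⟩
  | append_singleton ω i ih =>
    obtain ⟨τ, hsub, hred, hprod⟩ := ih
    have hmul : cs.wordProd (ω ++ [i]) = cs.wordProd τ * cs.simple i := by
      simp [wordProd_append, hprod]
    by_cases hdesc : cs.IsRightDescent (cs.wordProd τ) i
    · obtain ⟨k, hk, hkt⟩ :=
        ((cs.isRightInversion_simple_iff_isRightDescent _ i).2 hdesc).exists_eraseIdx
      refine ⟨τ.eraseIdx k, ((List.eraseIdx_sublist τ k).trans hsub).trans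
        (List.sublist_append_left _ _), ?_, by rw [hmul, hkt]⟩
      have h := cs.isRightDescent_iff.1 hdesc
      rw [hkt, hred.eq] at h
      rw [IsReduced, List.length_eraseIdx_of_lt hk]
      omega
    · refine ⟨τ ++ [i], hsub.append (List.Sublist.refl _), ?_, by
        rw [hmul, wordProd_append, wordProd_singleton]⟩
      have h := cs.not_isRightDescent_iff.1 hdesc
      rw [IsReduced, wordProd_append, wordProd_singleton, h, hred.eq]
      simp

/-- `x` is obtained from `z` by a length-decreasing right multiplication by a reflection. -/
def ReflectionStep (x z : W) : Prop :=
  ∃ t, cs.IsRightInversion z t ∧ x = z * t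

/-- Multiplying a reflection step on the right by a simple reflection gives a reflection step,
unless the step is multiplication by that simple reflection. -/
theorem IsRightInversion.reflectionStep_mul_simple {cs : CoxeterSystem M W} {z t : W}
    (h : cs.IsRightInversion z t) {i : B} (hti : t ≠ cs.simple i) :
    cs.ReflectionStep (z * t * cs.simple i) (z * cs.simple i) := by
  obtain ⟨τ, hred, hτ⟩ := cs.exists_isReduced (z * cs.simple i)
  have hz : z = cs.wordProd (τ ++ [i]) := by
    simp [wordProd_append, ← hτ]
  refine ⟨cs.simple i * t * cs.simple i, ⟨by simpa using h.1.conj (cs.simple i), ?_⟩, by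
    simp [mul_assoc]⟩
  have hzt : z * cs.simple i * (cs.simple i * t * cs.simple i) = z * t * cs.simple i := by
    simp [mul_assoc]
  rw [hzt]
  obtain ⟨k, hk, hkt⟩ := IsRightInversion.exists_eraseIdx (hz ▸ h)
  rw [← hz] at hkt
  rcases Nat.lt_or_ge k τ.length with hk' | hk'
  · rw [hkt, List.eraseIdx_append_of_lt_length hk', wordProd_append, wordProd_singleton,
      simple_mul_simple_cancel_right, hτ, hred.eq]
    refine (cs.length_wordProd_le _).trans_lt ?_
    rw [List.length_eraseIdx_of_lt hk']
    omega
  · have hk'' : k = τ.length := by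
      simp at hk
      omega
    subst hk''
    rw [List.eraseIdx_append_of_length_le le_rfl] at hkt
    simp only [Nat.sub_self, List.eraseIdx_zero, List.tail_cons, List.append_nil, ← hτ] at hkt
    exact absurd (mul_left_cancel hkt) hti

open Relation

theorem reflTransGen_reflectionStep_mul_simple {x y : W}
    (h : ReflTransGen cs.ReflectionStep x y) (i : B) :
    ReflTransGen cs.ReflectionStep (x * cs.simple i) y ∨
      ReflTransGen cs.ReflectionStep (x * cs.simple i) (y * cs.simple i) := by
  induction h using ReflTransGen.head_induction_on with
  | refl => exact .inr .refl
  | @head x z hxz hzy ih =>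
    obtain ⟨t, ht, rfl⟩ := hxz
    by_cases hti : t = cs.simple i
    · left
      simpa [hti] using hzy
    · have hstep := ht.reflectionStep_mul_simple hti
      exact ih.imp (.head hstep) (.head hstep)

theorem exists_sublist_of_reflTransGen {ω : List B} {x : W}
    (h : ReflTransGen cs.ReflectionStep x (cs.wordProd ω)) :
    ∃ τ : List B, τ.Sublist ω ∧ cs.wordProd τ = x := by
  induction h using ReflTransGen.head_induction_on with
  | refl => exact ⟨ω, .refl _, rfl⟩
  | head hxz _ ih =>
    obtain ⟨τ, hsub, rfl⟩ := ih
    obtain ⟨t, ht, rfl⟩ := hxz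
    obtain ⟨k, -, hk⟩ := ht.exists_eraseIdx
    exact ⟨τ.eraseIdx k, (List.eraseIdx_sublist τ k).trans hsub, hk.symm⟩

theorem IsReduced.reflTransGen_of_sublist {cs : CoxeterSystem M W} {ω : List B}
    (hω : cs.IsReduced ω) {τ : List B} (hτ : τ.Sublist ω) :
    ReflTransGen cs.ReflectionStep (cs.wordProd τ) (cs.wordProd ω) := by
  induction ω using List.reverseRecOn generalizing τ with
  | nil => rw [List.sublist_nil.1 hτ]
  | append_singleton ω i ih =>
    have hω' : cs.IsReduced ω := by simpa using hω.take ω.length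
    have hstep : cs.ReflectionStep (cs.wordProd ω) (cs.wordProd (ω ++ [i])) := by
      refine ⟨cs.simple i, ⟨cs.isReflection_simple i, ?_⟩, by simp [wordProd_append]⟩
      rw [hω.eq]
      simp [wordProd_append, hω'.eq]
    obtain ⟨τ₁, τ₂, rfl, h₁, h₂⟩ := List.sublist_append_iff.1 hτ
    rcases List.sublist_singleton.1 h₂ with rfl | rfl
    · simpa using (ih hω' h₁).tail hstep
    · rw [wordProd_append, wordProd_singleton]
      rcases cs.reflTransGen_reflectionStep_mul_simple (ih hω' h₁) i with h | h
      · exact h.tail hstep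
      · rwa [wordProd_append, wordProd_singleton]

/-- The subword property: an element below `w` is the product of a subword of any given word
of `w`. -/
theorem exists_sublist_of_bruhatLE {ω : List B} {v : W}
    (h : bruhatLE cs v (cs.wordProd ω)) :
    ∃ τ : List B, τ.Sublist ω ∧ cs.wordProd τ = v := by
  obtain ⟨ω', hprod, hlen, τ, hτ, rfl⟩ := h
  have hω' : cs.IsReduced ω' := by rw [IsReduced, hprod, hlen]
  exact cs.exists_sublist_of_reflTransGen (hprod ▸ hω'.reflTransGen_of_sublist hτ)

theorem IsReduced.bruhatLE_of_sublist {cs : CoxeterSystem M W} {ω τ : List B}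
    (hω : cs.IsReduced ω) (hτ : τ.Sublist ω) : bruhatLE cs (cs.wordProd τ) (cs.wordProd ω) :=
  ⟨ω, rfl, hω.eq.symm, τ, hτ, rfl⟩

theorem wordProd_mem_closure {I : Set B} {ω : List B} (h : ∀ i ∈ ω, i ∈ I) :
    cs.wordProd ω ∈ Subgroup.closure (cs.simple '' I) := by
  refine Subgroup.list_prod_mem _ fun x hx => ?_
  obtain ⟨i, hi, rfl⟩ := List.mem_map.1 hx
  exact Subgroup.subset_closure ⟨i, h i hi, rfl⟩

/-- An element of a standard parabolic subgroup has a reduced word with letters in it. -/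
theorem exists_isReduced_of_mem_closure {I : Set B} {x : W}
    (hx : x ∈ Subgroup.closure (cs.simple '' I)) :
    ∃ ω : List B, (∀ i ∈ ω, i ∈ I) ∧ cs.IsReduced ω ∧ cs.wordProd ω = x := by
  have hword : ∃ ω : List B, (∀ i ∈ ω, i ∈ I) ∧ cs.wordProd ω = x := by
    induction hx using Subgroup.closure_induction with
    | mem x hx =>
      obtain ⟨i, hi, rfl⟩ := hx
      exact ⟨[i], by simpa using hi, by simp⟩
    | one => exact ⟨[], by simp, by simp⟩
    | mul x y _ _ hx hy =>
      obtain ⟨ω, hω, rfl⟩ := hx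
      obtain ⟨τ, hτ, rfl⟩ := hy
      refine ⟨ω ++ τ, ?_, cs.wordProd_append _ _⟩
      intro i hi
      exact (List.mem_append.1 hi).elim (hω i) (hτ i)
    | inv x _ hx =>
      obtain ⟨ω, hω, rfl⟩ := hx
      exact ⟨ω.reverse, by simpa using hω, by simp⟩
  obtain ⟨ω, hω, rfl⟩ := hword
  obtain ⟨τ, hsub, hred, hprod⟩ := cs.exists_isReduced_sublist ω
  exact ⟨τ, fun i hi => hω i (hsub.subset hi), hred, hprod⟩

theorem IsReduced.append_of_forall_length_le {cs : CoxeterSystem M W} {I : Set B} {α β : List B}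
    (hα : cs.IsReduced α) (hβ : cs.IsReduced β) (hI : ∀ i ∈ β, i ∈ I)
    (hmin : ∀ x ∈ Subgroup.closure (cs.simple '' I),
      cs.length (cs.wordProd α) ≤ cs.length (cs.wordProd α * x)) :
    cs.IsReduced (α ++ β) := by
  obtain ⟨τ, hsub, hred, hprod⟩ := cs.exists_isReduced_sublist (α ++ β)
  obtain ⟨α', β', rfl, hα', hβ'⟩ := List.sublist_append_iff.1 hsub
  rw [wordProd_append, wordProd_append] at hprod
  have hx := mul_mem (cs.wordProd_mem_closure hI)
    (inv_mem (cs.wordProd_mem_closure fun i hi => hI i (hβ'.subset hi)))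
  have hle := hmin _ hx
  rw [← mul_assoc, ← hprod, mul_inv_cancel_right, hα.eq] at hle
  obtain rfl := hα'.eq_of_length_le (hle.trans (cs.length_wordProd_le _))
  have hβle := cs.length_wordProd_le β'
  rw [mul_left_cancel hprod, hβ.eq] at hβle
  obtain rfl := hβ'.eq_of_length_le hβle
  exact hred

/-- An element without right descents in `I` has minimal length in its left coset of the
standard parabolic subgroup of `I`. -/
theorem length_le_length_mul_of_mem_closure {I : Set B} {w : W}
    (hw : ∀ i ∈ I, cs.length w < cs.length (w * cs.simple i)) {x : W}
    (hx : x ∈ Subgroup.closure (cs.simple '' I)) : cs.length w ≤ cs.length (w * x) := by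
  obtain ⟨y, hy, hmin⟩ := exists_minimalFor_of_wellFoundedLT
    (fun y => y ∈ Subgroup.closure (cs.simple '' I)) (fun y => cs.length (w * y))
    ⟨1, one_mem _⟩
  replace hmin : ∀ z ∈ Subgroup.closure (cs.simple '' I),
      cs.length (w * y) ≤ cs.length (w * z) := fun z hz =>
    (le_total _ _).elim id (hmin hz)
  obtain ⟨β, hβI, hβ, hβy⟩ := cs.exists_isReduced_of_mem_closure (inv_mem hy)
  obtain ⟨α, hα, hαy⟩ := cs.exists_isReduced (w * y)
  have hred : cs.IsReduced (α ++ β) := hα.append_of_forall_length_le hβ hβI fun z hz => by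
    rw [← hαy, mul_assoc]
    exact hmin _ (mul_mem hy hz)
  have hwαβ : w = cs.wordProd (α ++ β) := by
    rw [wordProd_append, ← hαy, hβy, mul_inv_cancel_right]
  rcases List.eq_nil_or_concat β with rfl | ⟨β₀, i, rfl⟩
  · have hy1 : y = 1 := by simpa using hβy
    simpa [hy1] using hmin x hx
  · exfalso
    have hlt := hw i (hβI i (by simp))
    have hws : w * cs.simple i = cs.wordProd (α ++ β₀) := by
      rw [hwαβ]
      simp [wordProd_append, mul_assoc]
    have hle := cs.length_wordProd_le (α ++ β₀)
    rw [hws] at hlt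
    rw [hwαβ, hred.eq] at hlt
    simp at hlt hle
    omega

end CoxeterSystem

/-- Let `I ⊆ S`, let `w ∈ W` with `l(ws) > l(w)` for all `s ∈ I`,
let `w' ∈ W_I` and `v ≤ ww'`. If `w ≤ v` then `v = w·w₁'` for some `w₁' ≤ w'`;
otherwise `v = w₁·w₁'` with `w₁ < w`, `w₁' ≤ w'` and `l(w₁w₁') = l(w₁) + l(w₁')`. -/
theorem stmt12 [Finite W] (cs : CoxeterSystem M W) (I : Set B) (w : W)
    (hw : ∀ i ∈ I, cs.length w < cs.length (w * cs.simple i))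
    (w' : W) (hw' : w' ∈ Subgroup.closure (cs.simple '' I))
    (v : W) (hv : bruhatLE cs v (w * w')) :
    (bruhatLE cs w v → ∃ w₁' : W, bruhatLE cs w₁' w' ∧ v = w * w₁') ∧
    (¬ bruhatLE cs w v → ∃ w₁ w₁' : W, bruhatLE cs w₁ w ∧ w₁ ≠ w ∧
      bruhatLE cs w₁' w' ∧ v = w₁ * w₁' ∧
      cs.length (w₁ * w₁') = cs.length w₁ + cs.length w₁') := by
  obtain ⟨α, hα, rfl⟩ := cs.exists_isReduced w
  obtain ⟨β, hβI, hβ, rfl⟩ := cs.exists_isReduced_of_mem_closure hw'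
  have hmin := fun x hx => cs.length_le_length_mul_of_mem_closure hw (x := x) hx
  rw [← cs.wordProd_append] at hv
  obtain ⟨σ, hσ, rfl⟩ := cs.exists_sublist_of_bruhatLE hv
  obtain ⟨τ, hτ, hred, hprod⟩ := cs.exists_isReduced_sublist σ
  rw [← hprod]
  obtain ⟨γ, δ, rfl, hγ, hδ⟩ := List.sublist_append_iff.1 (hτ.trans hσ)
  have hγred : cs.IsReduced γ := by simpa using hred.take γ.length
  have hδred : cs.IsReduced δ := by simpa using hred.drop γ.length
  constructor
  · intro hle
    obtain ⟨ρ, hρ, hρw⟩ := cs.exists_sublist_of_bruhatLE hle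
    obtain ⟨γ', δ', rfl, hγ', hδ'⟩ := List.sublist_append_iff.1 hρ
    have hδ'mem := cs.wordProd_mem_closure fun i hi => hβI i ((hδ'.trans hδ).subset hi)
    have hlen := hmin _ (inv_mem hδ'mem)
    rw [← hρw, cs.wordProd_append, mul_inv_cancel_right, ← cs.wordProd_append, hρw, hα.eq] at hlen
    have hγα : γ = α :=
      hγ.eq_of_length_le ((hlen.trans (cs.length_wordProd_le γ')).trans hγ'.length_le)
    exact ⟨cs.wordProd δ, hβ.bruhatLE_of_sublist hδ, by rw [cs.wordProd_append, hγα]⟩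
  · intro hnle
    refine ⟨cs.wordProd γ, cs.wordProd δ, hα.bruhatLE_of_sublist hγ, ?_,
      hβ.bruhatLE_of_sublist hδ, cs.wordProd_append γ δ, ?_⟩
    · intro heq
      exact hnle (heq ▸ hred.bruhatLE_of_sublist (List.sublist_append_left γ δ))
    · rw [← cs.wordProd_append, hred.eq, hγred.eq, hδred.eq, List.length_append]
end
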